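/- For every r ∈ {1,2,3,4}, the sublattice (1 − τ₀ʳ)(N) = {α − τ₀ʳ(α) : α ∈ N} equals M = {α ∈ N : P₀(α) = 0} = {α ∈ N : (α|x) = 0 for every x ∈ ℝ³⁰ fixed by τ₀}. -/

import Mathlib

/-- The standard inner product on ℝ⁵. -/
def ip5 (x y : Fin 5 → ℝ) : ℝ := ∑ i, x i * y i

/-- The A₄ root lattice: integer vectors in ℝ⁵ with coordinate sum 0. -/
def A4lat : Set (Fin 5 → ℝ) := {a | (∀ i, ∃ n : ℤ, a i = n) ∧ (∑ i, a i) = 0}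

/-- The dual lattice A₄* inside the sum-zero hyperplane. -/
def A4dual : Set (Fin 5 → ℝ) :=
  {x | (∑ i, x i) = 0 ∧ ∀ a ∈ A4lat, ∃ n : ℤ, ip5 x a = n}

noncomputable def w1 : Fin 5 → ℝ := (1 / 5 : ℝ) • ![4, -1, -1, -1, -1]

noncomputable def w4 : Fin 5 → ℝ := (1 / 5 : ℝ) • ![1, 1, 1, 1, -4]

/-- The four glue vectors, corresponding to the glue code rows
`(1,0,1,4,4,1)`, `(1,1,0,1,4,4)`, `(1,4,1,0,1,4)`, `(1,4,4,1,0,1)`. -/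
noncomputable def glue : Set (Fin 6 → Fin 5 → ℝ) :=
  {![w1, 0, w1, w4, w4, w1], ![w1, w1, 0, w1, w4, w4],
   ![w1, w4, w1, 0, w1, w4], ![w1, w4, w4, w1, 0, w1]}

/-- The block-diagonal copy of A₄⁶ in ℝ³⁰ = (ℝ⁵)⁶. -/
def A4six : Set (Fin 6 → Fin 5 → ℝ) := {x | ∀ k, x k ∈ A4lat}

/-- The Niemeier lattice with root lattice A₄⁶, generated by A₄⁶ and the glue vectors. -/
noncomputable def NLat : AddSubgroup (Fin 6 → Fin 5 → ℝ) := AddSubgroup.closure (A4six ∪ glue)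

/-- The isometry τ₀ cyclically permuting the last five ℝ⁵-blocks:
`(x₁,x₂,x₃,x₄,x₅,x₆) ↦ (x₁,x₆,x₂,x₃,x₄,x₅)`. -/
def τ : (Fin 6 → Fin 5 → ℝ) → Fin 6 → Fin 5 → ℝ := fun x => ![x 0, x 5, x 1, x 2, x 3, x 4]

/-- The orthogonal projection onto the fixed subspace of τ₀. -/
noncomputable def P0 : (Fin 6 → Fin 5 → ℝ) → Fin 6 → Fin 5 → ℝ := fun x =>
  let m := (1 / 5 : ℝ) • (x 1 + x 2 + x 3 + x 4 + x 5)
  ![x 0, m, m, m, m, m]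


/-- The standard inner product on ℝ³⁰ = (ℝ⁵)⁶. -/
def ip30 (x y : Fin 6 → Fin 5 → ℝ) : ℝ := ∑ k, ip5 (x k) (y k)

/-- `τ` as an additive endomorphism. -/
def τHom : (Fin 6 → Fin 5 → ℝ) →+ Fin 6 → Fin 5 → ℝ where
  toFun := τ
  map_zero' := by ext k i; fin_cases k <;> rfl
  map_add' x y := by ext k i; fin_cases k <;> rfl

lemma τ_iterate_five (x : Fin 6 → Fin 5 → ℝ) : τ^[5] x = x := by
  ext k i; fin_cases k <;> rfl

lemma zero_mem_A4lat : (0 : Fin 5 → ℝ) ∈ A4lat := ⟨fun _ => ⟨0, by simp⟩, by simp⟩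

lemma add_mem_A4lat {a b : Fin 5 → ℝ} (ha : a ∈ A4lat) (hb : b ∈ A4lat) : a + b ∈ A4lat := by
  refine ⟨fun i => ?_, ?_⟩
  · obtain ⟨m, hm⟩ := ha.1 i
    obtain ⟨n, hn⟩ := hb.1 i
    exact ⟨m + n, by simp [hm, hn]⟩
  · simp [Finset.sum_add_distrib, ha.2, hb.2]

lemma neg_mem_A4lat {a : Fin 5 → ℝ} (ha : a ∈ A4lat) : -a ∈ A4lat := by
  refine ⟨fun i => ?_, ?_⟩
  · obtain ⟨m, hm⟩ := ha.1 i
    exact ⟨-m, by simp [hm]⟩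
  · simp [ha.2]

/-- The lattice `A₄⁶` as an additive subgroup. -/
def A4sixSubgroup : AddSubgroup (Fin 6 → Fin 5 → ℝ) where
  carrier := A4six
  zero_mem' := fun _ => zero_mem_A4lat
  add_mem' := fun ha hb k => add_mem_A4lat (ha k) (hb k)
  neg_mem' := fun ha k => neg_mem_A4lat (ha k)

/-- The first glue vector; the other three are its images under `τ`. -/
noncomputable def glue₀ : Fin 6 → Fin 5 → ℝ := ![w1, 0, w1, w4, w4, w1]

lemma glue_eq : glue = {glue₀, τ glue₀, τ (τ glue₀), τ (τ (τ glue₀))} := rfl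

lemma A4six_subset_NLat {x : Fin 6 → Fin 5 → ℝ} (hx : x ∈ A4six) : x ∈ NLat :=
  AddSubgroup.subset_closure (Or.inl hx)

lemma glue_subset_NLat {x : Fin 6 → Fin 5 → ℝ} (hx : x ∈ glue) : x ∈ NLat :=
  AddSubgroup.subset_closure (Or.inr hx)

lemma five_smul_glue₀_mem : (5 : ℤ) • glue₀ ∈ A4sixSubgroup := by
  intro k
  refine ⟨fun i => ?_, ?_⟩
  · fin_cases k <;> fin_cases i <;> simp [glue₀, w1, w4] <;>
      first
        | (refine ⟨0, ?_⟩; norm_num; done)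
        | (refine ⟨1, ?_⟩; norm_num; done)
        | (refine ⟨-1, ?_⟩; norm_num; done)
        | (refine ⟨4, ?_⟩; norm_num; done)
        | (refine ⟨-4, ?_⟩; norm_num)
  · fin_cases k <;> simp [glue₀, w1, w4, Fin.sum_univ_succ] <;> norm_num

lemma τ_glue_relation :
    τ (τ (τ (τ glue₀))) - (τ glue₀ + (2 : ℤ) • τ (τ glue₀) - (2 : ℤ) • τ (τ (τ glue₀)))
      ∈ A4sixSubgroup := by
  intro k
  refine ⟨fun i => ?_, ?_⟩
  · fin_cases k <;> fin_cases i <;> simp [τ, glue₀, w1, w4] <;>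
      first
        | (refine ⟨0, ?_⟩; norm_num; done)
        | (refine ⟨1, ?_⟩; norm_num; done)
        | (refine ⟨-1, ?_⟩; norm_num; done)
        | (refine ⟨2, ?_⟩; norm_num; done)
        | (refine ⟨-2, ?_⟩; norm_num)
  · fin_cases k <;> simp [τ, glue₀, w1, w4, Fin.sum_univ_succ] <;> norm_num

lemma τ_mem_NLat {x : Fin 6 → Fin 5 → ℝ} (hx : x ∈ NLat) : τ x ∈ NLat := by
  have h1 : τ glue₀ ∈ NLat := glue_subset_NLat (by simp [glue_eq])
  have h2 : τ (τ glue₀) ∈ NLat := glue_subset_NLat (by simp [glue_eq])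
  have h3 : τ (τ (τ glue₀)) ∈ NLat := glue_subset_NLat (by simp [glue_eq])
  induction hx using AddSubgroup.closure_induction with
  | mem y hy =>
    rcases hy with hy | hy
    · refine A4six_subset_NLat fun k => ?_
      fin_cases k
      exacts [hy 0, hy 5, hy 1, hy 2, hy 3, hy 4]
    · rw [glue_eq] at hy
      rcases hy with rfl | rfl | rfl | rfl
      · exact h1
      · exact h2
      · exact h3
      · have := add_mem (A4six_subset_NLat τ_glue_relation)
          (sub_mem (add_mem h1 (zsmul_mem h2 2)) (zsmul_mem h3 2))
        rwa [sub_add_cancel] at this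
  | zero =>
    rw [show τ 0 = 0 from map_zero τHom]
    exact zero_mem _
  | add y z _ _ hy hz =>
    rw [show τ (y + z) = τ y + τ z from map_add τHom y z]
    exact add_mem hy hz
  | neg y _ hy =>
    rw [show τ (-y) = -τ y from map_neg τHom y]
    exact neg_mem hy

lemma τ_iterate_mem_NLat (n : ℕ) {x : Fin 6 → Fin 5 → ℝ} (hx : x ∈ NLat) : τ^[n] x ∈ NLat := by
  induction n with
  | zero => exact hx
  | succ n ih => rw [Function.iterate_succ_apply']; exact τ_mem_NLat ih

lemma exists_glue_coeff {x : Fin 6 → Fin 5 → ℝ} (hx : x ∈ NLat) :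
    ∃ a b c d : ℤ, x - (a • glue₀ + b • τ glue₀ + c • τ (τ glue₀) + d • τ (τ (τ glue₀)))
      ∈ A4sixSubgroup := by
  induction hx using AddSubgroup.closure_induction with
  | mem y hy =>
    rcases hy with hy | hy
    · exact ⟨0, 0, 0, 0, by simpa using (show y ∈ A4sixSubgroup from hy)⟩
    · rw [glue_eq] at hy
      rcases hy with rfl | rfl | rfl | rfl
      · exact ⟨1, 0, 0, 0, by simp⟩
      · exact ⟨0, 1, 0, 0, by simp⟩
      · exact ⟨0, 0, 1, 0, by simp⟩
      · exact ⟨0, 0, 0, 1, by simp⟩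
  | zero => exact ⟨0, 0, 0, 0, by simp⟩
  | add y z _ _ hy hz =>
    obtain ⟨a, b, c, d, h⟩ := hy
    obtain ⟨a', b', c', d', h'⟩ := hz
    refine ⟨a + a', b + b', c + c', d + d', ?_⟩
    convert add_mem h h' using 1
    module
  | neg y _ hy =>
    obtain ⟨a, b, c, d, h⟩ := hy
    refine ⟨-a, -b, -c, -d, ?_⟩
    convert neg_mem h using 1
    module

lemma P0_eq_zero_iff (x : Fin 6 → Fin 5 → ℝ) :
    P0 x = 0 ↔ x 0 = 0 ∧ x 1 + x 2 + x 3 + x 4 + x 5 = 0 := by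
  constructor
  · intro h
    refine ⟨congrFun h 0, ?_⟩
    have h1 : (1 / 5 : ℝ) • (x 1 + x 2 + x 3 + x 4 + x 5) = 0 := congrFun h 1
    exact (smul_eq_zero.1 h1).resolve_left (by norm_num)
  · rintro ⟨h0, h1⟩
    ext k i
    fin_cases k <;> simp [P0, h0, h1]

lemma P0_τ (x : Fin 6 → Fin 5 → ℝ) : P0 (τ x) = P0 x := by
  have h : x 5 + x 1 + x 2 + x 3 + x 4 = x 1 + x 2 + x 3 + x 4 + x 5 := by abel
  ext k i
  fin_cases k <;> simp [P0, τ, h]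

lemma P0_sub (x y : Fin 6 → Fin 5 → ℝ) : P0 (x - y) = P0 x - P0 y := by
  ext k i
  fin_cases k <;> simp [P0] <;> ring

lemma P0_sub_τ_iterate (n : ℕ) (x : Fin 6 → Fin 5 → ℝ) : P0 (x - τ^[n] x) = 0 := by
  have h : P0 (τ^[n] x) = P0 x := by
    induction n with
    | zero => rfl
    | succ n ih => rw [Function.iterate_succ_apply', P0_τ, ih]
  rw [P0_sub, h, sub_self]

lemma exists_sub_τ_of_mem_A4six {x : Fin 6 → Fin 5 → ℝ} (hx : x ∈ A4six) (h : P0 x = 0) :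
    ∃ y ∈ A4six, x = y - τ y := by
  obtain ⟨h0, h1⟩ := (P0_eq_zero_iff x).1 h
  have m2 := add_mem_A4lat (hx 1) (hx 2)
  have m3 := add_mem_A4lat m2 (hx 3)
  refine ⟨![0, x 1, x 1 + x 2, x 1 + x 2 + x 3, x 1 + x 2 + x 3 + x 4, 0], fun k => ?_, ?_⟩
  · fin_cases k
    exacts [zero_mem_A4lat, hx 1, m2, m3, add_mem_A4lat m3 (hx 4), zero_mem_A4lat]
  · ext k i
    have h1i := congrFun h1 i
    simp only [Pi.add_apply, Pi.zero_apply] at h1i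
    fin_cases k <;> simp [τ, h0]
    linarith

lemma exists_sub_τ_of_P0_eq_zero {x : Fin 6 → Fin 5 → ℝ} (hx : x ∈ NLat) (h : P0 x = 0) :
    ∃ y ∈ NLat, x = y - τ y := by
  obtain ⟨a, b, c, d, hz⟩ := exists_glue_coeff hx
  obtain ⟨h0, -⟩ := (P0_eq_zero_iff x).1 h
  obtain ⟨t, ht⟩ : ∃ t : ℤ, a + b + c + d = 5 * t := by
    obtain ⟨n, hn⟩ := (hz 0).1 1
    simp [h0, τ, glue₀, w1] at hn
    refine ⟨n, ?_⟩
    have : (a + b + c + d : ℝ) = 5 * n := by linarith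
    exact_mod_cast this
  let y₁ := -(b • glue₀ + c • (glue₀ + τ glue₀) + d • (glue₀ + τ glue₀ + τ (τ glue₀)))
  have g0 : glue₀ ∈ NLat := glue_subset_NLat (by simp [glue_eq])
  have g1 := τ_mem_NLat g0
  have g2 := τ_mem_NLat g1
  have hy₁ : y₁ ∈ NLat :=
    neg_mem (add_mem (add_mem (zsmul_mem g0 b) (zsmul_mem (add_mem g0 g1) c))
      (zsmul_mem (add_mem (add_mem g0 g1) g2) d))
  have hτ : τ y₁ = -(b • τ glue₀ + c • (τ glue₀ + τ (τ glue₀)) +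
      d • (τ glue₀ + τ (τ glue₀) + τ (τ (τ glue₀)))) := by
    change τHom y₁ = _
    simp only [y₁, map_neg, map_add, map_zsmul]
    rfl
  have hmem : x - (y₁ - τ y₁) ∈ A4sixSubgroup := by
    convert add_mem hz (zsmul_mem five_smul_glue₀_mem t) using 1
    obtain rfl : a = 5 * t - b - c - d := by linarith
    rw [hτ]
    module
  have hP : P0 (x - (y₁ - τ y₁)) = 0 := by
    rw [P0_sub, h, show P0 (y₁ - τ y₁) = 0 from P0_sub_τ_iterate 1 y₁, sub_self]
  obtain ⟨y₂, hy₂, hxy⟩ := exists_sub_τ_of_mem_A4six hmem hP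
  refine ⟨y₁ + y₂, add_mem hy₁ (A4six_subset_NLat hy₂), ?_⟩
  rw [show τ (y₁ + y₂) = τ y₁ + τ y₂ from map_add τHom y₁ y₂, add_sub_add_comm, ← hxy]
  abel

lemma exists_sub_τ_iterate (r s : ℕ) {y : Fin 6 → Fin 5 → ℝ} (hy : y ∈ NLat) :
    ∃ z ∈ NLat, y - τ^[r * s] y = z - τ^[r] z := by
  induction s with
  | zero => exact ⟨0, zero_mem _, by simp [show τ^[r] 0 = 0 from iterate_map_zero τHom r]⟩
  | succ s ih =>
    obtain ⟨z, hz, h⟩ := ih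
    refine ⟨z + τ^[r * s] y, add_mem hz (τ_iterate_mem_NLat _ hy), ?_⟩
    rw [show τ^[r] (z + τ^[r * s] y) = τ^[r] z + τ^[r] (τ^[r * s] y) from
      iterate_map_add τHom r _ _, add_sub_add_comm, ← h, ← Function.iterate_add_apply,
      show r * (s + 1) = r + r * s by ring]
    abel

lemma τ_P0 (x : Fin 6 → Fin 5 → ℝ) : τ (P0 x) = P0 x := by
  ext k i; fin_cases k <;> rfl

lemma ip30_eq_of_fixed (a : Fin 6 → Fin 5 → ℝ) {x : Fin 6 → Fin 5 → ℝ} (hx : τ x = x) :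
    ip30 a x = ip5 (a 0) (x 0) + ip5 (a 1 + a 2 + a 3 + a 4 + a 5) (x 1) := by
  have h2 : x 1 = x 2 := congrFun hx 2
  have h3 : x 2 = x 3 := congrFun hx 3
  have h4 : x 3 = x 4 := congrFun hx 4
  have h5 : x 4 = x 5 := congrFun hx 5
  simp only [ip30, ip5, Fin.sum_univ_six, ← h5, ← h4, ← h3, ← h2, Pi.add_apply, add_mul,
    Finset.sum_add_distrib]
  ring

lemma ip5_self_nonneg (x : Fin 5 → ℝ) : 0 ≤ ip5 x x :=
  Finset.sum_nonneg fun i _ => mul_self_nonneg (x i)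

lemma ip5_self_eq_zero {x : Fin 5 → ℝ} (h : ip5 x x = 0) : x = 0 := by
  ext i
  exact mul_self_eq_zero.1
    ((Finset.sum_eq_zero_iff_of_nonneg fun i _ => mul_self_nonneg (x i)).1 h i (Finset.mem_univ i))

lemma P0_eq_zero_iff_orthogonal (a : Fin 6 → Fin 5 → ℝ) :
    P0 a = 0 ↔ ∀ x : Fin 6 → Fin 5 → ℝ, τ x = x → ip30 a x = 0 := by
  rw [P0_eq_zero_iff]
  constructor
  · rintro ⟨h0, h1⟩ x hx
    rw [ip30_eq_of_fixed a hx, h0, h1]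
    simp [ip5]
  · intro h
    have key := h (P0 a) (τ_P0 a)
    rw [ip30_eq_of_fixed a (τ_P0 a)] at key
    have hs : ip5 (a 1 + a 2 + a 3 + a 4 + a 5) (P0 a 1) =
        1 / 5 * ip5 (a 1 + a 2 + a 3 + a 4 + a 5) (a 1 + a 2 + a 3 + a 4 + a 5) := by
      simp only [ip5, Finset.mul_sum]
      refine Finset.sum_congr rfl fun i _ => ?_
      simp [P0]
      ring
    rw [hs, show P0 a 0 = a 0 from rfl] at key
    have p0 := ip5_self_nonneg (a 0)
    have p1 := ip5_self_nonneg (a 1 + a 2 + a 3 + a 4 + a 5)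
    exact ⟨ip5_self_eq_zero (by linarith), ip5_self_eq_zero (by linarith)⟩

theorem stmt_12 :
    ∀ r ∈ ({1, 2, 3, 4} : Set ℕ),
      {y | ∃ α ∈ NLat, y = α - τ^[r] α} =
        {α | α ∈ NLat ∧ P0 α = 0} ∧
      {α | α ∈ NLat ∧ P0 α = 0} =
        {α | α ∈ NLat ∧ ∀ x : Fin 6 → Fin 5 → ℝ, τ x = x → ip30 α x = 0} := by
  intro r hr
  constructor
  · ext x
    constructor
    · rintro ⟨y, hy, rfl⟩
      exact ⟨sub_mem hy (τ_iterate_mem_NLat r hy), P0_sub_τ_iterate r y⟩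
    · rintro ⟨hx, h⟩
      obtain ⟨y, hy, rfl⟩ := exists_sub_τ_of_P0_eq_zero hx h
      obtain ⟨s, hs⟩ : ∃ s, τ^[r * s] y = τ y := by
        have h6 : τ^[6] y = τ y := by
          rw [Function.iterate_succ_apply, τ_iterate_five]
        rcases hr with rfl | rfl | rfl | rfl
        · exact ⟨1, rfl⟩
        · exact ⟨3, h6⟩
        · exact ⟨2, h6⟩
        · refine ⟨4, ?_⟩
          rw [show 4 * 4 = 5 + (5 + 6) from rfl, Function.iterate_add_apply, τ_iterate_five,
            Function.iterate_add_apply, τ_iterate_five, h6]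
      rw [← hs]
      exact exists_sub_τ_iterate r s hy
  · ext x
    exact and_congr_right fun _ => P0_eq_zero_iff_orthogonal x
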